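/- For the constrained candidate set built under the size constraint |τ| ≤ |τ₀|, any finite number d of repro samples, and any real γ₁ with cos(0.3π) < γ₁ < 1, the probability that the true model is not included satisfies ℙ_{(𝒰^d,Y)}(τ₀ ∉ S^(d)) ≤ L(γ₁) + [2·(arccos γ₁)^{n−|τ₀|−1}·p^{|τ₀|}]^d, where L(γ₁) = 6·exp[−(n/(18σ₀²))·{(1−γ₁²)·C_min − 36·(log p / n)·σ₀²}]. -/

import Mathlib

open MeasureTheory ProbabilityTheory Matrix Filter
open scoped ENNReal Classical

noncomputable section

namespace ReproSamples

/-- Squared Euclidean norm of a vector in `ℝⁿ`. -/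
def sqnorm {n : ℕ} (v : Fin n → ℝ) : ℝ := ∑ i, (v i) ^ 2

/-- The vector `β` with all coordinates outside `τ` set to `0`; this encodes the
vector `β_τ ∈ ℝ^{|τ|}`, so that `X_τ β_τ = X.mulVec (maskOn τ β)`. -/
def maskOn {p : ℕ} (τ : Finset (Fin p)) (β : Fin p → ℝ) : Fin p → ℝ :=
  fun j => if j ∈ τ then β j else 0

/-- The submatrix `X_τ` of the columns of `X` indexed by `τ`. -/
def subcols {n p : ℕ} (X : Matrix (Fin n) (Fin p) ℝ) (τ : Finset (Fin p)) :
    Matrix (Fin n) {j // j ∈ τ} ℝ :=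
  Matrix.of fun i j => X i j.1

/-- The matrix `M (MᵀM)⁻¹ Mᵀ` (orthogonal projection onto the column span of `M`
when `MᵀM` is invertible). -/
def projMat {n : ℕ} {m : Type} [Fintype m] [DecidableEq m]
    (M : Matrix (Fin n) m ℝ) : Matrix (Fin n) (Fin n) ℝ :=
  M * (Mᵀ * M)⁻¹ * Mᵀ

/-- The projection matrix `H_τ = X_τ (X_τᵀ X_τ)⁻¹ X_τᵀ`. -/
def proj {n p : ℕ} (X : Matrix (Fin n) (Fin p) ℝ) (τ : Finset (Fin p)) :
    Matrix (Fin n) (Fin n) ℝ :=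
  projMat (subcols X τ)

/-- Identifiability: `τ₀` is the unique minimizer of `|τ|` over
`{τ : X_τ β_τ = X_{τ₀} β₀ for some β_τ}` (here `β₀` is supported on `τ₀`). -/
def Identifiable {n p : ℕ} (X : Matrix (Fin n) (Fin p) ℝ) (τ₀ : Finset (Fin p))
    (β₀ : Fin p → ℝ) : Prop :=
  ∀ τ : Finset (Fin p), (∃ β : Fin p → ℝ, X.mulVec (maskOn τ β) = X.mulVec β₀) →
    τ ≠ τ₀ → τ₀.card < τ.card

/-- The separation constant `C_min`. -/
def Cmin {n p : ℕ} (X : Matrix (Fin n) (Fin p) ℝ) (τ₀ : Finset (Fin p))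
    (β₀ : Fin p → ℝ) : ℝ :=
  sInf ((fun τ : Finset (Fin p) =>
      sqnorm ((1 - proj X τ).mulVec (X.mulVec β₀)) /
        ((n * max (τ₀ \ τ).card 1 : ℕ) : ℝ)) ''
    {τ : Finset (Fin p) | τ ≠ τ₀ ∧ τ.card ≤ τ₀.card})

/-- Penalized objective `min_{β_τ, σ} ‖y − X_τ β_τ − σ u*‖² + λ|τ|`. -/
def objPen {n p : ℕ} (X : Matrix (Fin n) (Fin p) ℝ) (lam : ℝ) (y ustar : Fin n → ℝ)
    (τ : Finset (Fin p)) : ℝ :=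
  (⨅ bs : (Fin p → ℝ) × ℝ, sqnorm (y - X.mulVec (maskOn τ bs.1) - bs.2 • ustar)) +
    lam * τ.card

/-- Un-penalized objective `min_{β_τ, σ} ‖y − X_τ β_τ − σ u*‖²`. -/
def objFit {n p : ℕ} (X : Matrix (Fin n) (Fin p) ℝ) (y ustar : Fin n → ℝ)
    (τ : Finset (Fin p)) : ℝ :=
  ⨅ bs : (Fin p → ℝ) × ℝ, sqnorm (y - X.mulVec (maskOn τ bs.1) - bs.2 • ustar)

/-- Standard Gaussian measure `N(0, I_n)` on `ℝⁿ`. -/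
def stdGaussian (n : ℕ) : Measure (Fin n → ℝ) :=
  Measure.pi fun _ => gaussianReal 0 1

/-- Joint law of `(U, (U*_1, …, U*_d))`, all i.i.d. `N(0, I_n)`. -/
def jointMeasure (n d : ℕ) : Measure ((Fin n → ℝ) × (Fin d → Fin n → ℝ)) :=
  (stdGaussian n).prod (Measure.pi fun _ : Fin d => stdGaussian n)

/-- Squared cosine of the angle between two vectors. -/
def rho {n : ℕ} (v w : Fin n → ℝ) : ℝ := (v ⬝ᵥ w) ^ 2 / (sqnorm v * sqnorm w)

/-- `ρ_{τ⊥}(v, w) = ρ((I−H_τ)v, (I−H_τ)w)`. -/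
def rhoPerp {n p : ℕ} (X : Matrix (Fin n) (Fin p) ℝ) (τ : Finset (Fin p))
    (v w : Fin n → ℝ) : ℝ :=
  rho ((1 - proj X τ).mulVec v) ((1 - proj X τ).mulVec w)

/-- `ρ(v, τ) = ‖H_τ v‖²/‖v‖²`. -/
def rhoTau {n p : ℕ} (X : Matrix (Fin n) (Fin p) ℝ) (v : Fin n → ℝ)
    (τ : Finset (Fin p)) : ℝ :=
  sqnorm ((proj X τ).mulVec v) / sqnorm v

/-- The augmented matrix `(X_τ, u)`. -/
def augcols {n p : ℕ} (X : Matrix (Fin n) (Fin p) ℝ) (τ : Finset (Fin p))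
    (u : Fin n → ℝ) : Matrix (Fin n) ({j // j ∈ τ} ⊕ Unit) ℝ :=
  Matrix.of fun i j => Sum.elim (fun k : {j // j ∈ τ} => X i k.1) (fun _ => u i) j

/-- The projection matrix `H_{τ,u}` onto the column span of `(X_τ, u)`. -/
def projAug {n p : ℕ} (X : Matrix (Fin n) (Fin p) ℝ) (τ : Finset (Fin p))
    (u : Fin n → ℝ) : Matrix (Fin n) (Fin n) ℝ :=
  projMat (augcols X τ u)

/-- `γ²_{(u, τ₀)} = 1 − min_{|τ| < |τ₀|} ‖(I−H_{τ,u})X_{τ₀}β₀‖²/‖(I−H_τ)X_{τ₀}β₀‖²`. -/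
def gammaSq {n p : ℕ} (X : Matrix (Fin n) (Fin p) ℝ) (τ₀ : Finset (Fin p))
    (β₀ : Fin p → ℝ) (u : Fin n → ℝ) : ℝ :=
  1 - sInf ((fun τ : Finset (Fin p) =>
      sqnorm ((1 - projAug X τ u).mulVec (X.mulVec β₀)) /
        sqnorm ((1 - proj X τ).mulVec (X.mulVec β₀))) ''
    {τ : Finset (Fin p) | τ.card < τ₀.card})

/-- Residual sum of squares `min_β ‖y − X_τ β‖²`. -/
def rss {n p : ℕ} (X : Matrix (Fin n) (Fin p) ℝ) (y : Fin n → ℝ)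
    (τ : Finset (Fin p)) : ℝ :=
  ⨅ β : Fin p → ℝ, sqnorm (y - X.mulVec (maskOn τ β))

/-- `Y*_w = a + b (I−H_τ)u / ‖(I−H_τ)u‖`. -/
def ystar {n p : ℕ} (X : Matrix (Fin n) (Fin p) ℝ) (τ : Finset (Fin p))
    (a : Fin n → ℝ) (b : ℝ) (u : Fin n → ℝ) : Fin n → ℝ :=
  a + (b / Real.sqrt (sqnorm ((1 - proj X τ).mulVec u))) • ((1 - proj X τ).mulVec u)

/-- `p_{(w,τ)}(τ') = ℙ(T̃(Y*_w, τ) = τ')`. -/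
def pfun {n p : ℕ} (X : Matrix (Fin n) (Fin p) ℝ)
    (Tt : (Fin n → ℝ) → Finset (Fin p) → Finset (Fin p))
    (τ : Finset (Fin p)) (a : Fin n → ℝ) (b : ℝ) (τ' : Finset (Fin p)) : ℝ :=
  ((stdGaussian n) {u | Tt (ystar X τ a b u) τ = τ'}).toReal

/-- `B_α(τ, w) = {τ* : ∑_{τ' : p(τ') ≤ p(τ*)} p(τ') ≥ 1 − α}`. -/
def Bset {n p : ℕ} (X : Matrix (Fin n) (Fin p) ℝ)
    (Tt : (Fin n → ℝ) → Finset (Fin p) → Finset (Fin p)) (α : ℝ)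
    (τ : Finset (Fin p)) (a : Fin n → ℝ) (b : ℝ) : Set (Finset (Fin p)) :=
  {τstar | 1 - α ≤
    ∑ τ' ∈ Finset.univ.filter (fun τ' => pfun X Tt τ a b τ' ≤ pfun X Tt τ a b τstar),
      pfun X Tt τ a b τ'}

/-- `τ ∈ Γ̄^τ_α(y)`-membership test: `T̃(y,τ) ∈ B_α(τ, W̃(y,τ))` with
`W̃(y,τ) = (H_τ y, ‖(I−H_τ)y‖)`. -/
def inCS {n p : ℕ} (X : Matrix (Fin n) (Fin p) ℝ)
    (Tt : (Fin n → ℝ) → Finset (Fin p) → Finset (Fin p)) (α : ℝ)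
    (y : Fin n → ℝ) (τ : Finset (Fin p)) : Prop :=
  Tt y τ ∈ Bset X Tt α τ ((proj X τ).mulVec y)
    (Real.sqrt (sqnorm ((1 - proj X τ).mulVec y)))

/-- `O_{τ,Λ}`: orthogonal projection onto the column span of `(I−H_{τ∖Λ}) X_{Λ∩τ}`. -/
def projO {n p : ℕ} (X : Matrix (Fin n) (Fin p) ℝ) (τ Λ : Finset (Fin p)) :
    Matrix (Fin n) (Fin n) ℝ :=
  projMat ((1 - proj X (τ \ Λ)) * subcols X (Λ ∩ τ))

/-- The nuclear mapping `T̃(y, (β_Λ, τ))` with values in `EReal` (it takes the value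
`⊤ = +∞` when `β_i ≠ 0` for some `i ∈ Λ ∖ τ`). -/
def Tnuc {n p : ℕ} (X : Matrix (Fin n) (Fin p) ℝ) (Λ τ : Finset (Fin p))
    (β : Fin p → ℝ) (y : Fin n → ℝ) : EReal :=
  if ∃ i ∈ Λ \ τ, β i ≠ 0 then ⊤
  else if Λ ∩ τ = ∅ then 0
  else ((((y - X.mulVec (maskOn Λ β)) ⬝ᵥ (projO X τ Λ).mulVec (y - X.mulVec (maskOn Λ β))) /
    (((y - X.mulVec (maskOn Λ β)) ⬝ᵥ (1 - proj X τ).mulVec (y - X.mulVec (maskOn Λ β))) /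
      ((n : ℝ) - τ.card)) : ℝ) : EReal)

/-- The statistic `u ↦ (uᵀ O_{τ,Λ} u)/(uᵀ(I−H_τ)u/(n−|τ|))`. -/
def fstat {n p : ℕ} (X : Matrix (Fin n) (Fin p) ℝ) (τ Λ : Finset (Fin p))
    (u : Fin n → ℝ) : ℝ :=
  (u ⬝ᵥ (projO X τ Λ).mulVec u) / ((u ⬝ᵥ (1 - proj X τ).mulVec u) / ((n : ℝ) - τ.card))

/-- The `α`-quantile `q_α(τ, Λ)` of the law of `fstat` under `N(0, I_n)`. -/
def qant {n p : ℕ} (X : Matrix (Fin n) (Fin p) ℝ) (τ Λ : Finset (Fin p)) (α : ℝ) : ℝ :=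
  sInf {x : ℝ | α ≤ (((stdGaussian n).map (fstat X τ Λ)) (Set.Iic x)).toReal}


section gaussA

lemma gauss_exp_lin (t : ℝ) : ∫⁻ x, ENNReal.ofReal (Real.exp (t * x)) ∂(gaussianReal 0 1) =
    ENNReal.ofReal (Real.exp (t ^ 2 / 2)) := by
  have h := mgf_gaussianReal (p := gaussianReal 0 1) (X := id) (μ := 0) (v := 1) (by simp) t
  rw [← ofReal_integral_eq_lintegral_ofReal]
  · simp only [mgf, id] at h
    rw [h]; simp
  · exact integrable_exp_mul_gaussianReal t
  · exact Eventually.of_forall fun x => (Real.exp_pos _).le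

lemma gauss_exp_sq (c : ℝ) (hc : c < 1 / 2) :
    ∫⁻ x, ENNReal.ofReal (Real.exp (c * x ^ 2)) ∂(gaussianReal 0 1) =
    ENNReal.ofReal (Real.sqrt (1 / (1 - 2 * c))) := by
  rw [gaussianReal_of_var_ne_zero 0 one_ne_zero, lintegral_withDensity_eq_lintegral_mul₀
    (by fun_prop) (by fun_prop)]
  have h1 : ∀ x : ℝ, (gaussianPDF 0 1 * fun x => ENNReal.ofReal (Real.exp (c * x ^ 2))) x
      = ENNReal.ofReal ((Real.sqrt (2 * Real.pi))⁻¹ * Real.exp (-(1/2 - c) * x ^ 2)) := by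
    intro x
    simp only [Pi.mul_apply, gaussianPDF, gaussianPDFReal]
    rw [← ENNReal.ofReal_mul (by positivity), mul_assoc, ← Real.exp_add]
    simp only [NNReal.coe_one, mul_one, sub_zero]
    congr 3
    ring
  simp_rw [h1]
  rw [← ofReal_integral_eq_lintegral_ofReal]
  · rw [integral_const_mul, integral_gaussian, ← Real.sqrt_inv, ← Real.sqrt_mul (by positivity)]
    congr 2
    have : (1:ℝ)/2 - c ≠ 0 := by linarith
    have : (1:ℝ) - 2*c ≠ 0 := by linarith
    have := Real.pi_ne_zero
    have : (1:ℝ) - c*2 ≠ 0 := by linarith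
    field_simp
    
  · exact (integrable_exp_neg_mul_sq (by linarith)).const_mul _
  · exact Eventually.of_forall fun x => by positivity

lemma gauss_tail (a : ℝ) (ha : 0 ≤ a) :
    gaussianReal 0 1 {t | a ≤ |t|} ≤ 2 * ENNReal.ofReal (Real.exp (-(a ^ 2) / 2)) := by
  have key : ∀ s : ℝ, s ^ 2 = 1 → gaussianReal 0 1 {t | a ≤ s * t} ≤
      ENNReal.ofReal (Real.exp (-(a ^ 2) / 2)) := by
    intro s hs
    calc gaussianReal 0 1 {t | a ≤ s * t}
        = ∫⁻ t, Set.indicator {t | a ≤ s * t} 1 t ∂(gaussianReal 0 1) := by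
          rw [lintegral_indicator_one (measurableSet_le (by fun_prop) (by fun_prop))]
      _ ≤ ∫⁻ t, ENNReal.ofReal (Real.exp (-a^2)) * ENNReal.ofReal (Real.exp ((a * s) * t))
            ∂(gaussianReal 0 1) := by
          refine lintegral_mono fun t => ?_
          rw [← ENNReal.ofReal_mul (Real.exp_pos _).le, ← Real.exp_add]
          by_cases h : a ≤ s * t
          · rw [Set.indicator_of_mem (by exact h)]
            simp only [Pi.one_apply, ENNReal.one_le_ofReal, Real.one_le_exp_iff]
            nlinarith
          · rw [Set.indicator_of_notMem (by exact h)]; simp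
      _ = _ := by
          rw [lintegral_const_mul _ (by fun_prop), gauss_exp_lin,
            ← ENNReal.ofReal_mul (Real.exp_pos _).le, ← Real.exp_add]
          congr 2
          rw [mul_pow, hs]; ring
  calc gaussianReal 0 1 {t | a ≤ |t|}
      ≤ gaussianReal 0 1 ({t | a ≤ 1 * t} ∪ {t | a ≤ (-1) * t}) := by
        refine measure_mono fun t ht => ?_
        simp only [Set.mem_ofPred_eq, Set.mem_union, one_mul, neg_mul] at *
        exact le_abs.1 ht
    _ ≤ _ := by
        refine (measure_union_le _ _).trans ?_
        rw [two_mul]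
        exact add_le_add (key 1 (by norm_num)) (key (-1) (by norm_num))

lemma lint_prod {ι : Type*} [Fintype ι] (f : ι → ℝ → ℝ≥0∞) (hf : ∀ i, Measurable (f i)) :
    ∫⁻ x : ι → ℝ, ∏ i, f i (x i) ∂(Measure.pi fun _ => gaussianReal 0 1) =
      ∏ i, ∫⁻ t, f i t ∂(gaussianReal 0 1) := by
  have h := iIndepFun_pi (μ := fun _ : ι => gaussianReal 0 1) (X := fun i => f i)
    (fun i => (hf i).aemeasurable)
  have h2 := lintegral_prod_eq_prod_lintegral_of_indepFun Finset.univ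
    (fun i (x : ι → ℝ) => f i (x i)) h (fun i => (hf i).comp (measurable_pi_apply i))
  rw [h2]
  refine Finset.prod_congr rfl fun i _ => ?_
  exact (measurePreserving_eval (fun _ : ι => gaussianReal 0 1) i).lintegral_comp (hf i)

variable {E : Type*} [NormedAddCommGroup E] [InnerProductSpace ℝ E] [FiniteDimensional ℝ E]

lemma exists_basis (V : Submodule ℝ E) (T : Set E) (hT : Orthonormal ℝ ((↑) : T → E))
    (hTV : ∀ t ∈ T, t ∈ Vᗮ) : ∃ (u : Finset E) (b : OrthonormalBasis u ℝ E), ⇑b = ((↑) : u → E) ∧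
      T ⊆ u ∧ ∀ i : u, (i : E) ∈ V ∨ (i : E) ∈ Vᗮ := by
  set B := stdOrthonormalBasis ℝ V
  have hs : Orthonormal ℝ ((↑) : (T ∪ Set.range (fun i => (B i : E)) : Set E) → E) := by
    rw [orthonormal_subtype_iff_ite] at *
    rintro v (hv | ⟨i, rfl⟩) w (hw | ⟨j, rfl⟩)
    · exact hT v hv w hw
    · have h0 := (Submodule.mem_orthogonal' V v).1 (hTV v hv) _ (B j).2
      rw [h0, if_neg]
      rintro rfl
      have : (B j : E) = 0 := inner_self_eq_zero.1 h0
      have h2 := B.orthonormal.1 j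
      rw [Submodule.coe_norm, this] at h2
      simp at h2
    · have h0 := (Submodule.mem_orthogonal V w).1 (hTV w hw) _ (B i).2
      dsimp only
      rw [h0, if_neg]
      intro h
      rw [← h] at h0
      have : (B i : E) = 0 := inner_self_eq_zero.1 h0
      have h2 := B.orthonormal.1 i
      rw [Submodule.coe_norm, this] at h2
      simp at h2
    · have := orthonormal_iff_ite.1 B.orthonormal i j
      rw [Submodule.coe_inner] at this
      dsimp only
      rw [this]
      by_cases hij : i = j
      · simp [hij]
      · rw [if_neg hij, if_neg]
        intro h
        exact hij (B.toBasis.injective (by simpa using Subtype.ext h))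
  obtain ⟨u, b, hu, hb⟩ := hs.exists_orthonormalBasis_extension
  refine ⟨u, b, hb, fun t ht => hu (Or.inl ht), fun i => ?_⟩
  by_cases hi : (i : E) ∈ Set.range (fun i => (B i : E))
  · obtain ⟨j, hj⟩ := hi
    left; rw [← hj]; exact (B j).2
  · right
    have : ∀ j, inner ℝ (B j : E) (i : E) = 0 := by
      intro j
      have hj : (B j : E) ∈ u := hu (Or.inr ⟨j, rfl⟩)
      have h3 := orthonormal_iff_ite.1 b.orthonormal ⟨_, hj⟩ i
      rw [hb] at h3
      dsimp only at h3
      rw [h3, if_neg]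
      intro h
      exact hi ⟨j, by rw [← h]⟩
    rw [Submodule.mem_orthogonal]
    intro v hv
    have h4 := B.sum_repr ⟨v, hv⟩
    have h5 : v = ∑ j, B.repr ⟨v, hv⟩ j • (B j : E) := by
      have := congrArg (Subtype.val) h4
      simpa using this.symm
    rw [h5, sum_inner]
    refine Finset.sum_eq_zero fun j _ => ?_
    rw [inner_smul_left, this, mul_zero]

variable (V : Submodule ℝ E) {u : Finset E} (b : OrthonormalBasis u ℝ E)

lemma starProj_sum (h : ∀ i, b i ∈ V ∨ b i ∈ Vᗮ) (x : u → ℝ) :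
    V.starProjection (∑ i, x i • b i) = ∑ i ∈ Finset.univ.filter (fun i => b i ∈ V), x i • b i := by
  rw [map_sum, Finset.sum_filter]
  refine Finset.sum_congr rfl fun i _ => ?_
  rw [map_smul]
  split_ifs with hi
  · rw [Submodule.starProjection_eq_self_iff.2 hi]
  · rw [(Submodule.starProjection_apply_eq_zero_iff V).2 ((h i).resolve_left hi), smul_zero]

lemma norm_starProj_sum (h : ∀ i, b i ∈ V ∨ b i ∈ Vᗮ) (x : u → ℝ) :
    ‖V.starProjection (∑ i, x i • b i)‖ ^ 2 =
      ∑ i ∈ Finset.univ.filter (fun i => b i ∈ V), x i ^ 2 := by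
  rw [starProj_sum V b h, ← real_inner_self_eq_norm_sq, b.orthonormal.inner_sum]
  refine Finset.sum_congr rfl fun i _ => ?_
  simp [sq]

lemma card_basis (h : ∀ i, b i ∈ V ∨ b i ∈ Vᗮ) :
    (Finset.univ.filter (fun i => b i ∈ V)).card = Module.finrank ℝ V := by
  have hV : V = Submodule.span ℝ (Set.range fun i : {i // b i ∈ V} => b i) := by
    apply le_antisymm
    · intro x hx
      rw [← Submodule.starProjection_eq_self_iff.2 hx, ← b.sum_repr x, starProj_sum V b h]
      refine Submodule.sum_mem _ fun i hi => Submodule.smul_mem _ _ (Submodule.subset_span ?_)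
      exact ⟨⟨i, (Finset.mem_filter.1 hi).2⟩, rfl⟩
    · rw [Submodule.span_le]
      rintro _ ⟨i, rfl⟩
      exact i.2
  have hli : LinearIndependent ℝ (fun i : {i // b i ∈ V} => b i) :=
    b.orthonormal.linearIndependent.comp _ Subtype.val_injective
  have h2 := finrank_span_eq_card hli
  rw [← hV] at h2
  rw [h2, Fintype.card_subtype]

variable [MeasurableSpace E] [BorelSpace E]

lemma gauss_quad (c : ℝ) (hc : c < 1 / 2) (v : E) (hv : v ∈ Vᗮ) :
    ∫⁻ x, ENNReal.ofReal (Real.exp (c * ‖V.starProjection x‖ ^ 2 + inner ℝ v x))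
      ∂(ProbabilityTheory.stdGaussian E) =
    ENNReal.ofReal (Real.sqrt (1 / (1 - 2 * c)) ^ (Module.finrank ℝ V) *
      Real.exp (‖v‖ ^ 2 / 2)) := by
  obtain ⟨u, b, hb, -, h⟩ := exists_basis V ∅ (by simp) (by simp)
  have h' : ∀ i, b i ∈ V ∨ b i ∈ Vᗮ := by intro i; rw [hb]; exact h i
  rw [stdGaussian_eq_map_pi_orthonormalBasis b, lintegral_map (by fun_prop) (by fun_prop)]
  have h1 : ∀ x : u → ℝ, ENNReal.ofReal (Real.exp (c * ‖V.starProjection (∑ i, x i • b i)‖ ^ 2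
      + inner ℝ v (∑ i, x i • b i))) = ∏ i, (fun t => if b i ∈ V then
        ENNReal.ofReal (Real.exp (c * t ^ 2)) else
        ENNReal.ofReal (Real.exp (inner ℝ v (b i) * t))) (x i) := by
    intro x
    rw [norm_starProj_sum V b h', inner_sum, Finset.mul_sum, Finset.sum_filter,
      ← Finset.sum_add_distrib, Real.exp_sum, ENNReal.ofReal_prod_of_nonneg
      (fun i _ => (Real.exp_pos _).le)]
    refine Finset.prod_congr rfl fun i _ => ?_
    dsimp only
    rw [inner_smul_right]
    split_ifs with hi
    · rw [(Submodule.mem_orthogonal' V v).1 hv _ hi]; simp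
    · rw [zero_add, mul_comm]
  rw [lintegral_congr h1, lint_prod (fun (i : u) (t : ℝ) => if b i ∈ V then
        ENNReal.ofReal (Real.exp (c * t ^ 2)) else
        ENNReal.ofReal (Real.exp (inner ℝ v (b i) * t)))]
  · have h2 : ∀ i, ∫⁻ t, (if b i ∈ V then
        ENNReal.ofReal (Real.exp (c * t ^ 2)) else
        ENNReal.ofReal (Real.exp (inner ℝ v (b i) * t))) ∂(gaussianReal 0 1) =
        ENNReal.ofReal ((if b i ∈ V then Real.sqrt (1 / (1 - 2 * c)) else 1) *
          Real.exp ((inner ℝ v (b i)) ^ 2 / 2)) := by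
      intro i
      split_ifs with hi
      · rw [gauss_exp_sq c hc, (Submodule.mem_orthogonal' V v).1 hv _ hi]; simp
      · rw [gauss_exp_lin, one_mul]
    simp_rw [h2]
    rw [← ENNReal.ofReal_prod_of_nonneg, Finset.prod_mul_distrib, ← Real.exp_sum,
      ← Finset.sum_div, b.sum_sq_inner_left, Finset.prod_ite]
    · rw [Finset.prod_const, Finset.prod_const_one, mul_one, card_basis V b h']
    · intro i _
      split_ifs <;> positivity
  · intro i
    split_ifs <;> fun_prop

lemma gauss_cone (r : ℝ) (hr : 0 ≤ r) (e : E) (he : ‖e‖ = 1) (heV : e ∈ Vᗮ) :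
    (ProbabilityTheory.stdGaussian E) {x | r * ‖V.starProjection x‖ ≤ |inner ℝ e x|} ≤
    2 * ENNReal.ofReal (Real.sqrt (1 / (1 + r ^ 2)) ^ (Module.finrank ℝ V)) := by
  have hm : Measurable fun x : E =>
      2 * ENNReal.ofReal (Real.exp ((-r^2/2) * ‖V.starProjection x‖ ^ 2 + inner ℝ (0:E) x)) := by
    fun_prop
  have hms : MeasurableSet {x : E | r * ‖V.starProjection x‖ ≤ |inner ℝ e x|} :=
    measurableSet_le (by fun_prop) (by fun_prop)
  have hq := gauss_quad V (-r^2/2) (by nlinarith [sq_nonneg r]) 0 (Submodule.zero_mem _)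
  have : 2 * ENNReal.ofReal (Real.sqrt (1 / (1 + r ^ 2)) ^ (Module.finrank ℝ V)) =
    ∫⁻ x, 2 * ENNReal.ofReal (Real.exp ((-r^2/2) * ‖V.starProjection x‖ ^ 2 + inner ℝ (0:E) x))
      ∂(ProbabilityTheory.stdGaussian E) := by
    rw [lintegral_const_mul _ (by fun_prop), hq]
    congr 2
    simp only [norm_zero]
    rw [show (1:ℝ) - 2 * (-r^2/2) = 1 + r^2 by ring]
    simp
  rw [this, ← lintegral_indicator_one hms]
  obtain ⟨u, b, hb, hTu, h⟩ := exists_basis V {e}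
    (by rw [orthonormal_subtype_iff_ite]; simp [he]) (by simpa using heV)
  have h' : ∀ i, b i ∈ V ∨ b i ∈ Vᗮ := by intro i; rw [hb]; exact h i
  have heu : e ∈ u := hTu rfl
  have hbe : b ⟨e, heu⟩ = e := by rw [hb]
  have heV' : b ⟨e, heu⟩ ∉ V := by
    rw [hbe]; intro h3
    have := (Submodule.mem_orthogonal V e).1 heV e h3
    rw [inner_self_eq_zero] at this
    simp [this] at he
  have hin : ∀ x : u → ℝ, inner ℝ e (∑ i, x i • b i) = x ⟨e, heu⟩ := by
    intro x
    conv_lhs => rw [← hbe]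
    rw [b.orthonormal.inner_right_fintype]
  have hup : ∀ (x : u → ℝ) (t : ℝ),
      ‖V.starProjection (∑ i, Function.update x ⟨e, heu⟩ t i • b i)‖ =
      ‖V.starProjection (∑ i, x i • b i)‖ := by
    intro x t
    congr 1
    rw [starProj_sum V b h', starProj_sum V b h']
    refine Finset.sum_congr rfl fun i hi => ?_
    rw [Function.update_of_ne]
    rintro rfl
    exact heV' (Finset.mem_filter.1 hi).2
  rw [stdGaussian_eq_map_pi_orthonormalBasis b,
    lintegral_map (measurable_one.indicator hms) (by fun_prop), lintegral_map hm (by fun_prop)]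
  refine lintegral_le_of_lmarginal_le {⟨e, heu⟩}
    ((measurable_one.indicator hms).comp (by fun_prop)) (hm.comp (by fun_prop)) ?_
  intro x
  rw [lmarginal_singleton, lmarginal_singleton]
  simp only [hup, inner_zero_left, add_zero, lintegral_const, measure_univ, mul_one]
  have : ∀ t, ({x : E | r * ‖V.starProjection x‖ ≤ |inner ℝ e x|}.indicator (1 : E → ℝ≥0∞))
      (∑ i, Function.update x ⟨e, heu⟩ t i • b i) =
      {t : ℝ | r * ‖V.starProjection (∑ i, x i • b i)‖ ≤ |t|}.indicator 1 t := by
    intro t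
    simp only [Set.indicator, Set.mem_ofPred_eq, hup, hin, Function.update_self, Pi.one_apply]
  simp_rw [this]
  rw [lintegral_indicator_one (measurableSet_le (by fun_prop) (by fun_prop))]
  refine (gauss_tail _ (by positivity)).trans (le_of_eq ?_)
  congr 3
  ring

end gaussA

section geo
variable {E : Type*} [NormedAddCommGroup E] [InnerProductSpace ℝ E] [FiniteDimensional ℝ E]

lemma geo1 (K : Submodule ℝ E) (m x w e : E) (g : ℝ) (hg0 : 0 < g) (hg1 : g < 1)
    (hw : w = Kᗮ.starProjection m) (hw0 : w ≠ 0) (he : e = ‖w‖⁻¹ • w)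
    (hlt : ‖(K ⊔ Submodule.span ℝ {x})ᗮ.starProjection m‖ ^ 2 < (1 - g ^ 2) * ‖w‖ ^ 2) :
    g / Real.sqrt (1 - g ^ 2) * ‖(K ⊔ Submodule.span ℝ {w})ᗮ.starProjection x‖ ≤ |inner ℝ e x| := by
  set V := (K ⊔ Submodule.span ℝ {w})ᗮ with hV
  have hs : 0 < 1 - g ^ 2 := by nlinarith
  set s := Real.sqrt (1 - g ^ 2) with hsdef
  have hs0 : 0 < s := Real.sqrt_pos.2 hs
  have hs2 : s ^ 2 = 1 - g ^ 2 := Real.sq_sqrt hs.le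
  have hwn : 0 < ‖w‖ := norm_pos_iff.2 hw0
  have hwK : w ∈ Kᗮ := by rw [hw]; exact Submodule.starProjection_apply_mem _ _
  have heK : e ∈ Kᗮ := by rw [he]; exact Submodule.smul_mem _ _ hwK
  have hen : ‖e‖ = 1 := by rw [he, norm_smul, norm_inv, norm_norm, inv_mul_cancel₀ hwn.ne']
  have hmK : m - w ∈ K := by
    rw [hw, Submodule.starProjection_orthogonal_val]
    simp [Submodule.starProjection_apply_mem]
  have hem : inner ℝ e m = ‖w‖ := by
    have h1 : inner ℝ e (m - w) = 0 := (Submodule.mem_orthogonal' K e).1 heK _ hmK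
    have h2 : inner ℝ e w = ‖w‖ := by
      rw [he, inner_smul_left, real_inner_self_eq_norm_sq]
      simp; field_simp
    rw [inner_sub_right, h2] at h1; linarith
  have hVproj : ∀ k ∈ K ⊔ Submodule.span ℝ {w}, V.starProjection k = 0 := by
    intro k hk
    rw [Submodule.starProjection_apply_eq_zero_iff, hV, Submodule.orthogonal_orthogonal]
    exact hk
  have hmV : V.starProjection m = 0 := by
    apply hVproj
    have := Submodule.add_mem_sup hmK (Submodule.mem_span_singleton_self (R := ℝ) w)
    simpa using this
  have heV : ∀ y ∈ V, inner ℝ e y = 0 := by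
    intro y hy
    have : e ∈ K ⊔ Submodule.span ℝ {w} := by
      rw [he]
      exact Submodule.mem_sup_right (Submodule.smul_mem _ _ (Submodule.mem_span_singleton_self w))
    exact (Submodule.mem_orthogonal _ y).1 hy e this
  set A := K ⊔ Submodule.span ℝ {x} with hA
  obtain ⟨k, hk, c', hc', ha⟩ := Submodule.mem_sup.1 (Submodule.starProjection_apply_mem A m)
  obtain ⟨c, rfl⟩ := Submodule.mem_span_singleton.1 hc'
  set q := Aᗮ.starProjection m with hq
  have hqe : q = m - (k + c • x) := by
    rw [hq, Submodule.starProjection_orthogonal_val, ha]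
  have h1 : inner ℝ e q = ‖w‖ - c * inner ℝ e x := by
    rw [hqe, inner_sub_right, inner_add_right, hem, inner_smul_right,
      (Submodule.mem_orthogonal' K e).1 heK _ hk, zero_add]
  have h2 : ‖V.starProjection q‖ ^ 2 = c ^ 2 * ‖V.starProjection x‖ ^ 2 := by
    rw [hqe, map_sub, map_add, hmV, hVproj k (Submodule.mem_sup_left hk), map_smul]
    rw [zero_add, zero_sub, norm_neg, norm_smul, mul_pow, Real.norm_eq_abs, sq_abs]
  have h3 : (inner ℝ e q) ^ 2 + ‖V.starProjection q‖ ^ 2 ≤ ‖q‖ ^ 2 := by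
    rw [Submodule.norm_sq_eq_add_norm_sq_starProjection q V, add_comm]
    refine add_le_add le_rfl ?_
    have h4 : inner ℝ e q = inner ℝ e (Vᗮ.starProjection q) := by
      rw [Submodule.starProjection_orthogonal_val, inner_sub_right,
        heV _ (Submodule.starProjection_apply_mem _ _), sub_zero]
    rw [h4, ← sq_abs]
    have := abs_real_inner_le_norm e (Vᗮ.starProjection q)
    rw [hen, one_mul] at this
    gcongr
  by_contra hcon
  push Not at hcon
  have h5 : (inner ℝ e x) ^ 2 ≤ (g / s * ‖V.starProjection x‖) ^ 2 := by
    rw [← sq_abs]; gcongr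
  rw [mul_pow, div_pow, hs2, div_mul_eq_mul_div, le_div_iff₀ hs] at h5
  rw [h1, h2] at h3
  have h6 := lt_of_le_of_lt h3 hlt
  set t := inner ℝ e x
  set z := ‖V.starProjection x‖
  set W := ‖w‖
  have h7 : g ^ 2 * ((W - c * t) ^ 2 + c ^ 2 * z ^ 2) < g ^ 2 * ((1 - g ^ 2) * W ^ 2) := by
    gcongr
  have h8 : c ^ 2 * (t ^ 2 * (1 - g ^ 2)) ≤ c ^ 2 * (g ^ 2 * z ^ 2) := by gcongr
  nlinarith [sq_nonneg (c * t - g ^ 2 * W)]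

lemma geo2 (A W : Submodule ℝ E) (hWA : W ≤ A) (x : E) :
    ‖Wᗮ.starProjection x‖ ^ 2 = ‖Aᗮ.starProjection x‖ ^ 2 + ‖(A ⊓ Wᗮ).starProjection x‖ ^ 2 := by
  have h1 : (A ⊓ Wᗮ).starProjection x = A.starProjection x - W.starProjection x := by
    apply Submodule.eq_starProjection_of_mem_orthogonal'
      (z := x - (A.starProjection x - W.starProjection x))
    · refine ⟨Submodule.sub_mem _ (Submodule.starProjection_apply_mem _ _)
        (hWA (Submodule.starProjection_apply_mem _ _)), ?_⟩
      have h2 : x - W.starProjection x ∈ Wᗮ := Submodule.sub_starProjection_mem_orthogonal x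
      have h3 : x - A.starProjection x ∈ Wᗮ :=
        Submodule.orthogonal_le hWA (Submodule.sub_starProjection_mem_orthogonal x)
      have := Submodule.sub_mem _ h2 h3
      simpa using this
    · have h3 : x - A.starProjection x ∈ (A ⊓ Wᗮ)ᗮ :=
        Submodule.orthogonal_le inf_le_left (Submodule.sub_starProjection_mem_orthogonal x)
      have h4 : W.starProjection x ∈ (A ⊓ Wᗮ)ᗮ := by
        apply Submodule.orthogonal_le (inf_le_right : A ⊓ Wᗮ ≤ Wᗮ)
        rw [Submodule.orthogonal_orthogonal]
        exact Submodule.starProjection_apply_mem _ _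
      have := Submodule.add_mem _ h3 h4
      convert this using 1
      abel
    · abel
  have h2 : Wᗮ.starProjection x = Aᗮ.starProjection x + (A ⊓ Wᗮ).starProjection x := by
    rw [h1, Submodule.starProjection_orthogonal_val, Submodule.starProjection_orthogonal_val]
    abel
  rw [h2]
  have h3 : inner ℝ (Aᗮ.starProjection x) ((A ⊓ Wᗮ).starProjection x) = 0 :=
    (Submodule.mem_orthogonal' A _).1 (Submodule.starProjection_apply_mem _ _) _
      (Submodule.starProjection_apply_mem (A ⊓ Wᗮ) x).1
  have := norm_add_sq_eq_norm_sq_add_norm_sq_of_inner_eq_zero _ _ h3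
  nlinarith

lemma finrank_geo (A W : Submodule ℝ E) (hWA : W ≤ A) :
    Module.finrank ℝ (A ⊓ Wᗮ : Submodule ℝ E) + Module.finrank ℝ W ≤ Module.finrank ℝ A := by
  have h1 := Submodule.finrank_sup_add_finrank_inf_eq (A ⊓ Wᗮ) W
  have h2 : (A ⊓ Wᗮ) ⊓ W = ⊥ := by
    rw [inf_assoc, inf_comm Wᗮ, Submodule.inf_orthogonal_eq_bot, inf_bot_eq]
  rw [h2, finrank_bot, add_zero] at h1
  rw [← h1]
  exact Submodule.finrank_mono (sup_le inf_le_left hWA)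

variable [MeasurableSpace E] [BorelSpace E]

lemma prob_bad (K : Submodule ℝ E) (m : E) (g : ℝ) (hg0 : 0 < g) (hg1 : g < 1) (N : ℕ)
    (hN : N + Module.finrank ℝ K + 1 ≤ Module.finrank ℝ E) :
    ProbabilityTheory.stdGaussian E {x | ‖(K ⊔ Submodule.span ℝ {x})ᗮ.starProjection m‖ ^ 2 <
      (1 - g ^ 2) * ‖Kᗮ.starProjection m‖ ^ 2} ≤
    2 * ENNReal.ofReal (Real.arccos g ^ N) := by
  by_cases hw0 : Kᗮ.starProjection m = 0
  · refine le_trans (le_of_eq ?_) zero_le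
    convert measure_empty (μ := ProbabilityTheory.stdGaussian E)
    rw [Set.eq_empty_iff_forall_notMem]
    intro x hx
    rw [hw0] at hx
    simp only [Set.mem_ofPred_eq, norm_zero] at hx
    nlinarith [sq_nonneg ‖(K ⊔ Submodule.span ℝ {x})ᗮ.starProjection m‖]
  set w := Kᗮ.starProjection m with hw
  have hs : 0 < 1 - g ^ 2 := by nlinarith
  have hwn : 0 < ‖w‖ := norm_pos_iff.2 hw0
  have hen : ‖‖w‖⁻¹ • w‖ = 1 := by rw [norm_smul, norm_inv, norm_norm, inv_mul_cancel₀ hwn.ne']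
  refine (measure_mono (fun x hx => geo1 K m x w (‖w‖⁻¹ • w) g hg0 hg1 hw hw0 rfl hx)).trans ?_
  refine (gauss_cone (K ⊔ Submodule.span ℝ {w})ᗮ (g / Real.sqrt (1 - g ^ 2)) (by positivity)
    (‖w‖⁻¹ • w) hen ?_).trans ?_
  · rw [Submodule.orthogonal_orthogonal]
    exact Submodule.mem_sup_right (Submodule.smul_mem _ _ (Submodule.mem_span_singleton_self w))
  · gcongr
    have h1 : 1 / (1 + (g / Real.sqrt (1 - g ^ 2)) ^ 2) = 1 - g ^ 2 := by
      rw [div_pow, Real.sq_sqrt hs.le]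
      field_simp
      ring
    rw [h1, ← Real.sin_arccos]
    have ha : 0 ≤ Real.arccos g := Real.arccos_nonneg g
    have hsin0 : 0 ≤ Real.sin (Real.arccos g) := by rw [Real.sin_arccos]; positivity
    have hd : N ≤ Module.finrank ℝ (K ⊔ Submodule.span ℝ {w})ᗮ := by
      have h2 := Submodule.finrank_add_finrank_orthogonal (K ⊔ Submodule.span ℝ {w})
      have h3 := Submodule.finrank_add_le_finrank_add_finrank K (Submodule.span ℝ {w})
      have h4 : Module.finrank ℝ (Submodule.span ℝ {w}) ≤ 1 := by
        simpa using finrank_span_le_card (R := ℝ) ({w} : Set E)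
      omega
    exact (pow_le_pow_of_le_one hsin0 (Real.sin_le_one _) hd).trans
      (pow_le_pow_left₀ hsin0 (Real.sin_le ha) _)

lemma prob_fail (A W : Submodule ℝ E) (hWA : W ≤ A) (m : E) (σ : ℝ) (hσ : 0 < σ) (j : ℕ)
    (hj : Module.finrank ℝ A ≤ Module.finrank ℝ W + j) (D : ℝ)
    (hD : D ≤ ‖Aᗮ.starProjection m‖ ^ 2) :
    ProbabilityTheory.stdGaussian E {x | ‖Aᗮ.starProjection (m + σ • x)‖ ^ 2 ≤
      ‖Wᗮ.starProjection (σ • x)‖ ^ 2} ≤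
    ENNReal.ofReal (2 ^ j * Real.exp (- D / (8 * σ ^ 2))) := by
  set q := Aᗮ.starProjection m with hq
  set V := A ⊓ Wᗮ with hV
  have hqA : q ∈ Aᗮ := Submodule.starProjection_apply_mem _ _
  have hqV : -(1 / (2 * σ)) • q ∈ Vᗮ :=
    Submodule.smul_mem _ _ (Submodule.orthogonal_le inf_le_left hqA)
  have hquad := gauss_quad V (1/4) (by norm_num) (-(1 / (2 * σ)) • q) hqV
  have hms : MeasurableSet {x : E | ‖Aᗮ.starProjection (m + σ • x)‖ ^ 2 ≤
      ‖Wᗮ.starProjection (σ • x)‖ ^ 2} := measurableSet_le (by fun_prop) (by fun_prop)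
  calc _ = ∫⁻ x, Set.indicator {x : E | ‖Aᗮ.starProjection (m + σ • x)‖ ^ 2 ≤
      ‖Wᗮ.starProjection (σ • x)‖ ^ 2} 1 x ∂(ProbabilityTheory.stdGaussian E) := by
          rw [lintegral_indicator_one hms]
    _ ≤ ∫⁻ x, ENNReal.ofReal (Real.exp (-‖q‖ ^ 2 / (4 * σ ^ 2))) *
          ENNReal.ofReal (Real.exp (1/4 * ‖V.starProjection x‖ ^ 2 +
            inner ℝ (-(1 / (2 * σ)) • q) x)) ∂(ProbabilityTheory.stdGaussian E) := by
        refine lintegral_mono fun x => ?_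
        rw [← ENNReal.ofReal_mul (Real.exp_pos _).le, ← Real.exp_add]
        by_cases h : ‖Aᗮ.starProjection (m + σ • x)‖ ^ 2 ≤ ‖Wᗮ.starProjection (σ • x)‖ ^ 2
        · rw [Set.indicator_of_mem (by exact h)]
          simp only [Pi.one_apply, ENNReal.one_le_ofReal, Real.one_le_exp_iff]
          have hg2 : ‖Wᗮ.starProjection (σ • x)‖ ^ 2 = ‖Aᗮ.starProjection (σ • x)‖ ^ 2 +
            ‖V.starProjection (σ • x)‖ ^ 2 := geo2 A W hWA (σ • x)
          rw [hg2, map_add, map_smul, map_smul, ← hq, norm_add_sq_real,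
            inner_smul_right, norm_smul (α := ℝ) σ (V.starProjection x), mul_pow,
            Real.norm_eq_abs, sq_abs] at h
          have h1 : inner ℝ q (Aᗮ.starProjection x) = inner ℝ q x := by
            rw [Submodule.starProjection_orthogonal_val, inner_sub_right,
              (Submodule.mem_orthogonal' A q).1 hqA _ (Submodule.starProjection_apply_mem _ _),
              sub_zero]
          rw [h1] at h
          rw [inner_smul_left]
          have h2 : -‖q‖ ^ 2 / (4 * σ ^ 2) + (1 / 4 * ‖V.starProjection x‖ ^ 2 +
              (-(1 / (2 * σ))) * inner ℝ q x) = (σ ^ 2 * ‖V.starProjection x‖ ^ 2 - ‖q‖ ^ 2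
                - 2 * (σ * inner ℝ q x)) / (4 * σ ^ 2) := by
            field_simp
            ring
          simp only [conj_trivial]
          rw [h2]
          apply div_nonneg _ (by positivity)
          linarith
        · rw [Set.indicator_of_notMem (by exact h)]; simp
    _ ≤ _ := by
        rw [lintegral_const_mul _ (by fun_prop), hquad, ← ENNReal.ofReal_mul (Real.exp_pos _).le]
        apply ENNReal.ofReal_le_ofReal
        have hdim : Module.finrank ℝ V ≤ j := by
          have := finrank_geo A W hWA
          rw [← hV] at this
          omega
        have hsq : Real.sqrt (1 / (1 - 2 * (1 / 4))) ≤ 2 := by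
          rw [Real.sqrt_le_left (by norm_num)]; norm_num
        have hsq1 : Real.sqrt (1 / (1 - 2 * (1 / 4))) ^ Module.finrank ℝ V ≤ 2 ^ j :=
          (pow_le_pow_left₀ (Real.sqrt_nonneg _) hsq _).trans
            (pow_le_pow_right₀ (by norm_num) hdim)
        rw [mul_left_comm, ← Real.exp_add]
        refine mul_le_mul hsq1 (Real.exp_le_exp.2 ?_) (Real.exp_pos _).le (by positivity)
        rw [norm_smul, mul_pow, Real.norm_eq_abs, sq_abs]
        have : -‖q‖ ^ 2 / (4 * σ ^ 2) + (-(1 / (2 * σ))) ^ 2 * ‖q‖ ^ 2 / 2 =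
          - ‖q‖ ^ 2 / (8 * σ ^ 2) := by field_simp; ring
        rw [this]
        gcongr
end geo

def colv {n p : ℕ} (X : Matrix (Fin n) (Fin p) ℝ) (j : Fin p) : EuclideanSpace ℝ (Fin n) :=
  WithLp.toLp 2 (fun i => X i j)

def Ksp {n p : ℕ} (X : Matrix (Fin n) (Fin p) ℝ) (τ : Finset (Fin p)) :
    Submodule ℝ (EuclideanSpace ℝ (Fin n)) := Submodule.span ℝ (colv X '' (τ : Set (Fin p)))

section bridge
variable {n p : ℕ} (X : Matrix (Fin n) (Fin p) ℝ)

lemma sqnorm_eq (v : Fin n → ℝ) : sqnorm v = ‖WithLp.toLp 2 v‖ ^ 2 := by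
  rw [EuclideanSpace.real_norm_sq_eq]; rfl

lemma mulVec_mask (τ : Finset (Fin p)) (β : Fin p → ℝ) :
    WithLp.toLp 2 (X.mulVec (maskOn τ β)) = ∑ j ∈ τ, β j • colv X j := by
  ext i
  simp [Matrix.mulVec, dotProduct, maskOn, colv, mul_comm]

lemma mem_Ksp (τ : Finset (Fin p)) (x : EuclideanSpace ℝ (Fin n)) :
    x ∈ Ksp X τ ↔ ∃ β : Fin p → ℝ, x = WithLp.toLp 2 (X.mulVec (maskOn τ β)) := by
  rw [Ksp, Submodule.mem_span_image_finset_iff_exists_fun']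
  simp_rw [mulVec_mask, eq_comm]

lemma finrank_Ksp (τ : Finset (Fin p)) : Module.finrank ℝ (Ksp X τ) ≤ τ.card := by
  have : colv X '' (τ : Set (Fin p)) = ((τ.image (colv X) : Finset _) : Set _) := by simp
  rw [Ksp, this]
  exact (finrank_span_finset_le_card _).trans Finset.card_image_le

lemma Ksp_union (τ τ' : Finset (Fin p)) : Ksp X (τ ∪ τ') = Ksp X τ ⊔ Ksp X τ' := by
  rw [Ksp, Finset.coe_union, Set.image_union, Submodule.span_union]; rfl

def Asp (u : Fin n → ℝ) (τ : Finset (Fin p)) : Submodule ℝ (EuclideanSpace ℝ (Fin n)) :=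
  Ksp X τ ⊔ Submodule.span ℝ {WithLp.toLp 2 u}

lemma objFit_eq (y u : Fin n → ℝ) (τ : Finset (Fin p)) :
    objFit X y u τ = ‖(Asp X u τ)ᗮ.starProjection (WithLp.toLp 2 y)‖ ^ 2 := by
  have hrw : ∀ bs : (Fin p → ℝ) × ℝ, sqnorm (y - X.mulVec (maskOn τ bs.1) - bs.2 • u) =
      ‖WithLp.toLp 2 y - (WithLp.toLp 2 (X.mulVec (maskOn τ bs.1)) + bs.2 • WithLp.toLp 2 u)‖ ^ 2 := by
    intro bs
    rw [sqnorm_eq]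
    congr 2
    rw [WithLp.toLp_sub, WithLp.toLp_sub, WithLp.toLp_smul]; abel
  unfold objFit
  apply le_antisymm
  · obtain ⟨k, hk, c', hc', ha⟩ := Submodule.mem_sup.1
      (Submodule.starProjection_apply_mem (Asp X u τ) (WithLp.toLp 2 y))
    obtain ⟨c, rfl⟩ := Submodule.mem_span_singleton.1 hc'
    obtain ⟨β, rfl⟩ := (mem_Ksp X τ k).1 hk
    refine (ciInf_le ⟨0, ?_⟩ (β, c)).trans ?_
    · rintro _ ⟨bs, rfl⟩
      exact Finset.sum_nonneg fun i _ => sq_nonneg _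
    · rw [hrw]
      dsimp only
      rw [ha, Submodule.starProjection_orthogonal_val]
  · apply le_ciInf
    intro bs
    rw [hrw]
    set a := (WithLp.toLp 2 (X.mulVec (maskOn τ bs.1)) + bs.2 • WithLp.toLp 2 u :
      EuclideanSpace ℝ (Fin n)) with haa
    have ha : a ∈ Asp X u τ := Submodule.add_mem_sup ((mem_Ksp X τ _).2 ⟨_, rfl⟩)
      (Submodule.smul_mem _ _ (Submodule.mem_span_singleton_self _))
    have h1 : (Asp X u τ)ᗮ.starProjection (WithLp.toLp 2 y) =
        (Asp X u τ)ᗮ.starProjection (WithLp.toLp 2 y - a) := by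
      rw [map_sub, (Submodule.starProjection_apply_eq_zero_iff (Asp X u τ)ᗮ (v := a)).2
        (by rwa [Submodule.orthogonal_orthogonal]), sub_zero]
    rw [h1]
    gcongr
    exact Submodule.norm_starProjection_apply_le _ _

lemma proj_eq (τ : Finset (Fin p)) (hG : IsUnit ((subcols X τ)ᵀ * subcols X τ).det)
    (m : Fin n → ℝ) : sqnorm ((1 - proj X τ).mulVec m) =
      ‖(Ksp X τ)ᗮ.starProjection (WithLp.toLp 2 m)‖ ^ 2 := by
  rw [sqnorm_eq, Submodule.starProjection_orthogonal_val]
  set M := subcols X τ with hM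
  have h1 : (Ksp X τ).starProjection (WithLp.toLp 2 m) = WithLp.toLp 2 ((proj X τ).mulVec m) := by
    apply Submodule.eq_starProjection_of_mem_orthogonal'
      (z := WithLp.toLp 2 ((1 - proj X τ).mulVec m))
    · rw [mem_Ksp]
      set c := ((Mᵀ * M)⁻¹ * Mᵀ).mulVec m with hc
      refine ⟨fun j => if h : j ∈ τ then c ⟨j, h⟩ else 0, ?_⟩
      rw [proj, projMat, ← hM, Matrix.mul_assoc, ← Matrix.mulVec_mulVec, ← hc, mulVec_mask]
      ext i
      simp only [WithLp.ofLp_sum, WithLp.ofLp_smul, Finset.sum_apply, Pi.smul_apply, smul_eq_mul,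
        Matrix.mulVec, dotProduct, colv, hM, subcols, Matrix.of_apply]
      rw [← Finset.sum_coe_sort τ]
      refine Finset.sum_congr rfl fun j _ => ?_
      simp [mul_comm]
    · rw [Ksp, Submodule.mem_orthogonal]
      have h0 : ∀ j ∈ τ, inner ℝ (colv X j) (WithLp.toLp 2 ((1 - proj X τ).mulVec m)) = 0 := by
        intro j hj
        have h2 : Mᵀ.mulVec ((1 - proj X τ).mulVec m) = 0 := by
          rw [Matrix.mulVec_mulVec, proj, projMat, ← hM, Matrix.mul_sub, Matrix.mul_one,
            ← Matrix.mul_assoc, ← Matrix.mul_assoc, Matrix.mul_nonsing_inv _ hG, Matrix.one_mul,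
            sub_self, Matrix.zero_mulVec]
        have h3 := congrFun h2 ⟨j, hj⟩
        simp only [Matrix.mulVec, dotProduct, Matrix.transpose_apply, hM, subcols,
          Matrix.of_apply, Pi.zero_apply] at h3
        rw [PiLp.inner_apply]
        simp only [colv, RCLike.inner_apply, conj_trivial]
        rw [← h3]
        refine Finset.sum_congr rfl fun i _ => ?_
        rw [mul_comm]; rfl
      intro v hv
      induction hv using Submodule.span_induction with
      | mem x hx => obtain ⟨j, hj, rfl⟩ := hx; exact h0 j hj
      | zero => simp
      | add x y _ _ hx hy => rw [inner_add_left, hx, hy, add_zero]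
      | smul a x _ hx => rw [inner_smul_left, hx, mul_zero]
    · rw [← WithLp.toLp_add, ← Matrix.add_mulVec]; simp
  rw [h1, ← WithLp.toLp_sub, Matrix.sub_mulVec, Matrix.one_mulVec]

lemma transfer (S : Set (EuclideanSpace ℝ (Fin n))) :
    stdGaussian n {u | WithLp.toLp 2 u ∈ S} =
      ProbabilityTheory.stdGaussian (EuclideanSpace ℝ (Fin n)) S := by
  rw [← map_pi_eq_stdGaussian]
  exact ((MeasurableEquiv.toLp 2 (Fin n → ℝ)).map_apply S).symm

lemma measurable_objFit (τ : Finset (Fin p)) :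
    Measurable fun z : (Fin n → ℝ) × (Fin n → ℝ) => objFit X z.1 z.2 τ := by
  apply UpperSemicontinuous.measurable
  apply upperSemicontinuous_ciInf
  · intro x
    refine ⟨0, ?_⟩
    rintro _ ⟨bs, rfl⟩
    exact Finset.sum_nonneg fun i _ => sq_nonneg _
  · intro bs
    apply Continuous.upperSemicontinuous
    unfold sqnorm
    fun_prop

instance (n : ℕ) : IsProbabilityMeasure (stdGaussian n) := by
  unfold stdGaussian; infer_instance

instance (n d : ℕ) : IsProbabilityMeasure (jointMeasure n d) := by
  unfold jointMeasure; infer_instance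

end bridge

section comb
variable {p : ℕ} (τ₀ : Finset (Fin p))

lemma exists_enum {α : Type*} [DecidableEq α] (t : Finset α) (ht : t.Nonempty) (k : ℕ) (hk : t.card ≤ k) :
    ∃ f : Fin k → α, Finset.univ.image f = t := by
  obtain ⟨a, ha⟩ := ht
  refine ⟨fun i => if h : (i : ℕ) < t.card then (t.equivFin.symm ⟨i, h⟩ : α) else a, ?_⟩
  ext x
  simp only [Finset.mem_image, Finset.mem_univ, true_and]
  constructor
  · rintro ⟨i, rfl⟩
    split_ifs
    · exact Finset.coe_mem _
    · exact ha
  · intro hx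
    have hlt := (t.equivFin ⟨x, hx⟩).2
    refine ⟨⟨t.equivFin ⟨x, hx⟩, hlt.trans_le hk⟩, ?_⟩
    simp

lemma count1 (h0 : τ₀.Nonempty) :
    (Finset.univ.filter fun τ : Finset (Fin p) => τ ≠ τ₀ ∧ τ.card ≤ τ₀.card).card ≤
      p ^ τ₀.card := by
  have h : (Finset.univ.filter fun τ : Finset (Fin p) => τ ≠ τ₀ ∧ τ.card ≤ τ₀.card) ⊆
      (Finset.univ : Finset (Fin τ₀.card → Fin p)).image
        (fun f => if Finset.univ.image f = τ₀ then ∅ else Finset.univ.image f) := by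
    intro τ hτ
    obtain ⟨h1, h2⟩ := (Finset.mem_filter.1 hτ).2
    rw [Finset.mem_image]
    rcases τ.eq_empty_or_nonempty with rfl | hne
    · obtain ⟨f, hf⟩ := exists_enum τ₀ h0 τ₀.card le_rfl
      exact ⟨f, Finset.mem_univ _, by rw [if_pos hf]⟩
    · obtain ⟨f, hf⟩ := exists_enum τ hne τ₀.card h2
      exact ⟨f, Finset.mem_univ _, by rw [hf, if_neg h1]⟩
  refine (Finset.card_le_card h).trans (Finset.card_image_le.trans ?_)
  simp

lemma count2 (h0 : τ₀.Nonempty) (j : ℕ) (hj : 1 ≤ j) :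
    (Finset.univ.filter fun τ : Finset (Fin p) => (τ₀ \ τ).card = j ∧ τ.card ≤ τ₀.card).card ≤
      (p ^ 2) ^ j := by
  have h : (Finset.univ.filter fun τ : Finset (Fin p) => (τ₀ \ τ).card = j ∧ τ.card ≤ τ₀.card) ⊆
      (Finset.univ : Finset ((Fin j → Fin p) × (Fin j → Fin p))).image
        (fun f => (τ₀ \ Finset.univ.image f.1) ∪ (Finset.univ.image f.2 \ τ₀)) := by
    intro τ hτ
    obtain ⟨h1, h2⟩ := (Finset.mem_filter.1 hτ).2
    rw [Finset.mem_image]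
    obtain ⟨f, hf⟩ := exists_enum (τ₀ \ τ) (Finset.card_pos.1 (by omega)) j h1.le
    have h3 : (τ \ τ₀).card ≤ j := by
      have h4 := Finset.card_sdiff_add_card_inter τ τ₀
      have h5 := Finset.card_sdiff_add_card_inter τ₀ τ
      rw [Finset.inter_comm] at h5
      omega
    have : ∃ g : Fin j → Fin p, Finset.univ.image g \ τ₀ = τ \ τ₀ := by
      rcases (τ \ τ₀).eq_empty_or_nonempty with he | hne
      · obtain ⟨a, ha⟩ := h0
        refine ⟨fun _ => a, ?_⟩
        rw [he, Finset.sdiff_eq_empty_iff_subset]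
        intro x hx
        simp only [Finset.mem_image] at hx
        obtain ⟨_, _, rfl⟩ := hx
        exact ha
      · obtain ⟨g, hg⟩ := exists_enum (τ \ τ₀) hne j h3
        refine ⟨g, ?_⟩
        rw [hg]; ext; simp
    obtain ⟨g, hg⟩ := this
    refine ⟨(f, g), Finset.mem_univ _, ?_⟩
    dsimp only
    rw [hf, hg]
    ext x
    simp only [Finset.mem_union, Finset.mem_sdiff]
    tauto
  refine (Finset.card_le_card h).trans (Finset.card_image_le.trans ?_)
  simp only [Finset.card_univ, Fintype.card_prod, Fintype.card_fun, Fintype.card_fin]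
  exact le_of_eq (by ring)

lemma sum_bound (h0 : τ₀.Nonempty) (a x : ℝ) (ha : 0 ≤ a) (hx : (p : ℝ) ^ 2 * a ≤ 2 * x)
    (hx6 : 6 * x ≤ 1) :
    ∑ τ ∈ Finset.univ.filter (fun τ : Finset (Fin p) => τ ≠ τ₀ ∧ τ.card ≤ τ₀.card),
      a ^ (τ₀ \ τ).card ≤ 6 * x := by
  have hx0 : 0 ≤ 2 * x := le_trans (by positivity) hx
  have hmaps : ∀ τ ∈ Finset.univ.filter (fun τ : Finset (Fin p) => τ ≠ τ₀ ∧ τ.card ≤ τ₀.card),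
      (τ₀ \ τ).card ∈ Finset.Ico 1 (τ₀.card + 1) := by
    intro τ hτ
    obtain ⟨h1, h2⟩ := (Finset.mem_filter.1 hτ).2
    rw [Finset.mem_Ico]
    constructor
    · rw [Nat.one_le_iff_ne_zero, Ne, Finset.card_eq_zero, Finset.sdiff_eq_empty_iff_subset]
      intro h
      exact h1 (Finset.eq_of_subset_of_card_le h h2).symm
    · exact Nat.lt_succ_of_le (Finset.card_le_card Finset.sdiff_subset)
  rw [← Finset.sum_fiberwise_of_maps_to hmaps]
  calc _ ≤ ∑ j ∈ Finset.Ico 1 (τ₀.card + 1), (2 * x) ^ j := by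
        refine Finset.sum_le_sum fun j hj => ?_
        rw [Finset.mem_Ico] at hj
        rw [Finset.sum_congr rfl (g := fun _ => a ^ j)
          (fun τ hτ => by rw [(Finset.mem_filter.1 hτ).2]), Finset.sum_const, nsmul_eq_mul]
        have hc : ((Finset.univ.filter (fun τ : Finset (Fin p) => τ ≠ τ₀ ∧ τ.card ≤ τ₀.card)).filter
            (fun τ => (τ₀ \ τ).card = j)).card ≤ (p ^ 2) ^ j := by
          refine (Finset.card_le_card ?_).trans (count2 τ₀ h0 j hj.1)
          intro τ hτ
          simp only [Finset.mem_filter, Finset.mem_univ, true_and] at hτ ⊢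
          tauto
        calc _ ≤ (((p ^ 2) ^ j : ℕ) : ℝ) * a ^ j := by gcongr
          _ = ((p : ℝ) ^ 2 * a) ^ j := by push_cast; rw [mul_pow]
          _ ≤ _ := by gcongr
    _ ≤ (2 * x) ^ 1 / (1 - 2 * x) := by
        exact geom_sum_Ico_le_of_lt_one hx0 (by linarith)
    _ ≤ 6 * x := by
        rw [pow_one, div_le_iff₀ (by linarith)]
        nlinarith
end comb

section assembly
variable {n p : ℕ} (X : Matrix (Fin n) (Fin p) ℝ) (τ₀ : Finset (Fin p)) (β₀ : Fin p → ℝ)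

def goodSet (γ₁ : ℝ) : Set (Fin n → ℝ) :=
  {u | ∀ τ : Finset (Fin p), τ ≠ τ₀ ∧ τ.card ≤ τ₀.card →
    (1 - γ₁ ^ 2) * sqnorm ((1 - proj X τ).mulVec (X.mulVec β₀)) ≤ objFit X (X.mulVec β₀) u τ}

def failSet (σ₀ : ℝ) : Set ((Fin n → ℝ) × (Fin n → ℝ)) :=
  {z | ∃ τ : Finset (Fin p), (τ ≠ τ₀ ∧ τ.card ≤ τ₀.card) ∧
    objFit X (X.mulVec β₀ + σ₀ • z.1) z.2 τ ≤ objFit X (X.mulVec β₀ + σ₀ • z.1) z.2 τ₀}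

lemma measurable_goodSet (γ₁ : ℝ) : MeasurableSet (goodSet X τ₀ β₀ γ₁) := by
  unfold goodSet
  simp only [Set.ofPred_forall]
  refine MeasurableSet.iInter fun τ => MeasurableSet.iInter fun _ => ?_
  refine measurableSet_le measurable_const ?_
  exact (measurable_objFit X τ).comp (f := fun u => (X.mulVec β₀, u)) (by fun_prop)

lemma measurable_failSet (σ₀ : ℝ) : MeasurableSet (failSet X τ₀ β₀ σ₀) := by
  unfold failSet
  simp only [Set.ofPred_exists]
  refine MeasurableSet.iUnion fun τ => ?_
  refine MeasurableSet.inter (MeasurableSet.const _) ?_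
  have h : ∀ τ, Measurable fun z : (Fin n → ℝ) × (Fin n → ℝ) =>
      objFit X (X.mulVec β₀ + σ₀ • z.1) z.2 τ := fun τ =>
    (measurable_objFit X τ).comp (f := fun z : (Fin n → ℝ) × (Fin n → ℝ) =>
      (X.mulVec β₀ + σ₀ • z.1, z.2)) (by fun_prop)
  exact measurableSet_le (h τ) (h τ₀)

lemma good_prob (h0 : τ₀.Nonempty) (hGram : ∀ τ : Finset (Fin p), τ.card ≤ τ₀.card →
      IsUnit ((subcols X τ)ᵀ * subcols X τ).det) (γ₁ : ℝ) (hg0 : 0 < γ₁) (hg1 : γ₁ < 1)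
    (hn : τ₀.card + 1 ≤ n) :
    stdGaussian n (goodSet X τ₀ β₀ γ₁)ᶜ ≤
      ENNReal.ofReal (2 * Real.arccos γ₁ ^ (n - τ₀.card - 1) * (p : ℝ) ^ τ₀.card) := by
  set T := Finset.univ.filter (fun τ : Finset (Fin p) => τ ≠ τ₀ ∧ τ.card ≤ τ₀.card) with hT
  have hsub : (goodSet X τ₀ β₀ γ₁)ᶜ ⊆ ⋃ τ ∈ T, {u | WithLp.toLp 2 u ∈
      {x | ‖(Ksp X τ ⊔ Submodule.span ℝ {x})ᗮ.starProjection (WithLp.toLp 2 (X.mulVec β₀))‖ ^ 2 <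
      (1 - γ₁ ^ 2) * ‖(Ksp X τ)ᗮ.starProjection (WithLp.toLp 2 (X.mulVec β₀))‖ ^ 2}} := by
    intro u hu
    simp only [goodSet, Set.mem_compl_iff, Set.mem_ofPred_eq, not_forall, not_le] at hu
    obtain ⟨τ, h1, h2⟩ := hu
    rw [proj_eq X τ (hGram τ h1.2), objFit_eq] at h2
    simp only [Set.mem_iUnion]
    exact ⟨τ, by simp [hT, h1], h2⟩
  refine (measure_mono hsub).trans ((measure_biUnion_finset_le _ _).trans ?_)
  have hτ : ∀ τ ∈ T, stdGaussian n {u | WithLp.toLp 2 u ∈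
      {x | ‖(Ksp X τ ⊔ Submodule.span ℝ {x})ᗮ.starProjection (WithLp.toLp 2 (X.mulVec β₀))‖ ^ 2 <
      (1 - γ₁ ^ 2) * ‖(Ksp X τ)ᗮ.starProjection (WithLp.toLp 2 (X.mulVec β₀))‖ ^ 2}} ≤
      2 * ENNReal.ofReal (Real.arccos γ₁ ^ (n - τ₀.card - 1)) := by
    intro τ hτ
    rw [transfer]
    apply prob_bad _ _ _ hg0 hg1
    have := finrank_Ksp X τ
    have h2 := (Finset.mem_filter.1 hτ).2.2
    rw [finrank_euclideanSpace_fin]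
    omega
  refine (Finset.sum_le_sum hτ).trans ?_
  rw [Finset.sum_const, nsmul_eq_mul]
  have hc := count1 τ₀ h0
  rw [← hT] at hc
  have ha : 0 ≤ Real.arccos γ₁ := Real.arccos_nonneg γ₁
  calc _ ≤ ((p ^ τ₀.card : ℕ) : ℝ≥0∞) *
        (2 * ENNReal.ofReal (Real.arccos γ₁ ^ (n - τ₀.card - 1))) := by gcongr
    _ = _ := by
      rw [ENNReal.ofReal_mul (by positivity), ENNReal.ofReal_mul (by norm_num), mul_comm]
      congr 1
      · simp
      · rw [← ENNReal.ofReal_natCast]; push_cast; rfl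

lemma fail_prob (h0 : τ₀.Nonempty) (hβsupp : ∀ j ∉ τ₀, β₀ j = 0)
    (hGram : ∀ τ : Finset (Fin p), τ.card ≤ τ₀.card →
      IsUnit ((subcols X τ)ᵀ * subcols X τ).det) (σ₀ : ℝ) (hσ₀ : 0 < σ₀)
    (γ₁ : ℝ) (hg0 : 0 < γ₁) (hg1 : γ₁ < 1) (hn : 1 ≤ n) (u : Fin n → ℝ)
    (hu : u ∈ goodSet X τ₀ β₀ γ₁) :
    stdGaussian n {U | (U, u) ∈ failSet X τ₀ β₀ σ₀} ≤
      ENNReal.ofReal (6 * Real.exp (-((n : ℝ) / (18 * σ₀ ^ 2)) *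
            ((1 - γ₁ ^ 2) * Cmin X τ₀ β₀ - 36 * (Real.log (p : ℝ) / (n : ℝ)) * σ₀ ^ 2))) := by
  have hp : 0 < p := by obtain ⟨a, _⟩ := h0; exact lt_of_le_of_lt (Nat.zero_le _) a.2
  have hs : 0 < 1 - γ₁ ^ 2 := by nlinarith
  have hnR : (0 : ℝ) < n := by exact_mod_cast hn
  set C := Cmin X τ₀ β₀ with hC
  have hbdd : ∀ y ∈ ((fun τ : Finset (Fin p) =>
      sqnorm ((1 - proj X τ).mulVec (X.mulVec β₀)) / ((n * max (τ₀ \ τ).card 1 : ℕ) : ℝ)) ''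
      {τ : Finset (Fin p) | τ ≠ τ₀ ∧ τ.card ≤ τ₀.card}), 0 ≤ y := by
    rintro _ ⟨τ, _, rfl⟩
    exact div_nonneg (Finset.sum_nonneg fun i _ => sq_nonneg _) (Nat.cast_nonneg _)
  have hC0 : 0 ≤ C := Real.sInf_nonneg hbdd
  set x := (p : ℝ) ^ 2 * Real.exp (-((1 - γ₁ ^ 2) * n * C / (18 * σ₀ ^ 2))) with hx
  have hL : Real.exp (-((n : ℝ) / (18 * σ₀ ^ 2)) *
      ((1 - γ₁ ^ 2) * C - 36 * (Real.log (p : ℝ) / (n : ℝ)) * σ₀ ^ 2)) = x := by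
    have h1 : -((n : ℝ) / (18 * σ₀ ^ 2)) *
      ((1 - γ₁ ^ 2) * C - 36 * (Real.log (p : ℝ) / (n : ℝ)) * σ₀ ^ 2) =
      Real.log p + Real.log p + -((1 - γ₁ ^ 2) * n * C / (18 * σ₀ ^ 2)) := by
      field_simp
      ring
    rw [h1, Real.exp_add, Real.exp_add, Real.exp_log (by exact_mod_cast hp), hx]
    ring
  rw [hL]
  by_cases hx6 : 1 < 6 * x
  · refine prob_le_one.trans ?_
    rw [ENNReal.one_le_ofReal]; exact hx6.le
  push Not at hx6
  set a := 2 * Real.exp (-((1 - γ₁ ^ 2) * n * C / (8 * σ₀ ^ 2))) with ha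
  have ha0 : 0 ≤ a := by positivity
  have hax : (p : ℝ) ^ 2 * a ≤ 2 * x := by
    rw [ha, hx, mul_left_comm]
    have : Real.exp (-((1 - γ₁ ^ 2) * n * C / (8 * σ₀ ^ 2))) ≤
        Real.exp (-((1 - γ₁ ^ 2) * n * C / (18 * σ₀ ^ 2))) := by
      apply Real.exp_le_exp.2
      apply neg_le_neg
      gcongr
      norm_num
    gcongr
  refine le_trans ?_ (ENNReal.ofReal_le_ofReal (sum_bound τ₀ h0 a x ha0 hax hx6))
  set T := Finset.univ.filter (fun τ : Finset (Fin p) => τ ≠ τ₀ ∧ τ.card ≤ τ₀.card) with hT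
  set m : EuclideanSpace ℝ (Fin n) := WithLp.toLp 2 (X.mulVec β₀) with hm
  have hmask : maskOn τ₀ β₀ = β₀ := by
    ext j; unfold maskOn; split_ifs with h
    · rfl
    · exact (hβsupp j h).symm
  have hmK : m ∈ Ksp X τ₀ := (mem_Ksp X τ₀ m).2 ⟨β₀, by rw [hmask]⟩
  let W : Finset (Fin p) → Submodule ℝ (EuclideanSpace ℝ (Fin n)) := fun τ => Asp X u (τ ∩ τ₀)
  have hmono : ∀ τ τ' : Finset (Fin p), τ ⊆ τ' → Asp X u τ ≤ Asp X u τ' := by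
    intro τ τ' h
    exact sup_le_sup_right (Submodule.span_mono (Set.image_mono (by exact_mod_cast h))) _
  have hsub : {U | (U, u) ∈ failSet X τ₀ β₀ σ₀} ⊆ ⋃ τ ∈ T, {U | WithLp.toLp 2 U ∈
      {x : EuclideanSpace ℝ (Fin n) | ‖(Asp X u τ)ᗮ.starProjection (m + σ₀ • x)‖ ^ 2 ≤
      ‖(Asp X u (τ ∩ τ₀))ᗮ.starProjection (σ₀ • x)‖ ^ 2}} := by
    rintro U ⟨τ, h1, h2⟩
    simp only [Set.mem_iUnion]
    refine ⟨τ, by simp [hT, h1], ?_⟩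
    rw [objFit_eq, objFit_eq, WithLp.toLp_add, WithLp.toLp_smul, ← hm] at h2
    have h3 : (Asp X u τ₀)ᗮ.starProjection (m + σ₀ • WithLp.toLp 2 U) =
        (Asp X u τ₀)ᗮ.starProjection (σ₀ • WithLp.toLp 2 U) := by
      rw [map_add, (Submodule.starProjection_apply_eq_zero_iff (Asp X u τ₀)ᗮ (v := m)).2
        (by rw [Submodule.orthogonal_orthogonal]; exact Submodule.mem_sup_left hmK), zero_add]
    have h4 := geo2 (Asp X u τ₀) (Asp X u (τ ∩ τ₀)) (hmono _ _ Finset.inter_subset_right)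
      (σ₀ • WithLp.toLp 2 U)
    rw [h3] at h2
    refine h2.trans ?_
    rw [h4]
    exact le_add_of_nonneg_right (sq_nonneg _)
  refine (measure_mono hsub).trans ((measure_biUnion_finset_le _ _).trans ?_)
  rw [ENNReal.ofReal_sum_of_nonneg (fun i _ => by positivity)]
  refine Finset.sum_le_sum fun τ hτ => ?_
  obtain ⟨h1, h2⟩ := (Finset.mem_filter.1 hτ).2
  rw [transfer]
  have hj1 : 1 ≤ (τ₀ \ τ).card := by
    rw [Nat.one_le_iff_ne_zero, Ne, Finset.card_eq_zero, Finset.sdiff_eq_empty_iff_subset]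
    intro h
    exact h1 (Finset.eq_of_subset_of_card_le h h2).symm
  have hjj : (τ \ τ₀).card ≤ (τ₀ \ τ).card := Finset.card_sdiff_le_card_sdiff_iff.2 h2
  have hCle : C ≤ sqnorm ((1 - proj X τ).mulVec (X.mulVec β₀)) /
      ((n * max (τ₀ \ τ).card 1 : ℕ) : ℝ) := by
    rw [hC, Cmin]
    exact csInf_le ⟨0, hbdd⟩ ⟨τ, ⟨h1, h2⟩, rfl⟩
  have hn0 : 0 < n * (τ₀ \ τ).card := by
    apply Nat.mul_pos
    · omega
    · omega
  have hden : (0 : ℝ) < ((n * (τ₀ \ τ).card : ℕ) : ℝ) := by exact_mod_cast hn0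
  rw [max_eq_left hj1, le_div_iff₀ hden] at hCle
  refine (prob_fail (Asp X u τ) (Asp X u (τ ∩ τ₀)) (hmono _ _ Finset.inter_subset_left) m σ₀ hσ₀
    (τ₀ \ τ).card ?_ ((1 - γ₁ ^ 2) * (C * ((n * (τ₀ \ τ).card : ℕ) : ℝ))) ?_).trans ?_
  · have hA : Asp X u τ = Asp X u (τ ∩ τ₀) ⊔ Ksp X (τ \ τ₀) := by
      have : τ = (τ ∩ τ₀) ∪ (τ \ τ₀) := by ext; simp; tauto
      unfold Asp
      conv_lhs => rw [this]
      rw [Ksp_union, sup_right_comm]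
    have h3 := Submodule.finrank_add_le_finrank_add_finrank (Asp X u (τ ∩ τ₀)) (Ksp X (τ \ τ₀))
    rw [← hA] at h3
    have := finrank_Ksp X (τ \ τ₀)
    omega
  · rw [hm, ← objFit_eq]
    refine le_trans ?_ (hu τ ⟨h1, h2⟩)
    gcongr
  · apply ENNReal.ofReal_le_ofReal
    rw [ha, mul_pow, ← Real.exp_nat_mul]
    apply le_of_eq
    congr 2
    push_cast
    ring

end assembly

/-- **Lemma (constrained candidate set, asymptotic-style bound).** For any
`cos(0.3π) < γ₁ < 1` and finite `d`,
`ℙ(τ₀ ∉ S^(d)) ≤ L(γ₁) + [2 (arccos γ₁)^{n−|τ₀|−1} p^{|τ₀|}]^d`. -/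
theorem constrained_candidate_set_gamma_bound {n p : ℕ}
    (X : Matrix (Fin n) (Fin p) ℝ) (τ₀ : Finset (Fin p)) (β₀ : Fin p → ℝ)
    (hβsupp : ∀ j ∉ τ₀, β₀ j = 0) (hβne : ∀ j ∈ τ₀, β₀ j ≠ 0)
    (σ₀ : ℝ) (hσ₀ : 0 < σ₀)
    (hGram : ∀ τ : Finset (Fin p), τ.card ≤ τ₀.card →
      IsUnit ((subcols X τ)ᵀ * subcols X τ).det)
    (hid : Identifiable X τ₀ β₀)
    (γ₁ : ℝ) (hγ₁ : Real.cos (0.3 * Real.pi) < γ₁ ∧ γ₁ < 1)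
    (tauHat : (Fin n → ℝ) → (Fin n → ℝ) → Finset (Fin p))
    (hcard : ∀ y ustar : Fin n → ℝ, (tauHat y ustar).card ≤ τ₀.card)
    (hmin : ∀ (y ustar : Fin n → ℝ) (τ : Finset (Fin p)), τ.card ≤ τ₀.card →
      objFit X y ustar (tauHat y ustar) ≤ objFit X y ustar τ)
    (d : ℕ) :
    jointMeasure n d
        {ω | ∀ b : Fin d, tauHat (X.mulVec β₀ + σ₀ • ω.1) (ω.2 b) ≠ τ₀} ≤
      ENNReal.ofReal
        (6 * Real.exp (-((n : ℝ) / (18 * σ₀ ^ 2)) *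
            ((1 - γ₁ ^ 2) * Cmin X τ₀ β₀ - 36 * (Real.log (p : ℝ) / (n : ℝ)) * σ₀ ^ 2)) +
          (2 * Real.arccos γ₁ ^ (n - τ₀.card - 1) * (p : ℝ) ^ τ₀.card) ^ d) := by
  have hg0 : 0 < γ₁ := by
    refine lt_trans ?_ hγ₁.1
    apply Real.cos_pos_of_mem_Ioo
    constructor <;> nlinarith [Real.pi_pos]
  have hg1 := hγ₁.2
  have ha : 0 ≤ Real.arccos γ₁ := Real.arccos_nonneg γ₁
  have htriv : 1 ≤ (2 * Real.arccos γ₁ ^ (n - τ₀.card - 1) * (p : ℝ) ^ τ₀.card) ^ d →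
      jointMeasure n d
        {ω | ∀ b : Fin d, tauHat (X.mulVec β₀ + σ₀ • ω.1) (ω.2 b) ≠ τ₀} ≤
      ENNReal.ofReal
        (6 * Real.exp (-((n : ℝ) / (18 * σ₀ ^ 2)) *
            ((1 - γ₁ ^ 2) * Cmin X τ₀ β₀ - 36 * (Real.log (p : ℝ) / (n : ℝ)) * σ₀ ^ 2)) +
          (2 * Real.arccos γ₁ ^ (n - τ₀.card - 1) * (p : ℝ) ^ τ₀.card) ^ d) := by
    intro h
    refine prob_le_one.trans ?_
    rw [ENNReal.one_le_ofReal]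
    have : 0 < Real.exp (-((n : ℝ) / (18 * σ₀ ^ 2)) *
            ((1 - γ₁ ^ 2) * Cmin X τ₀ β₀ - 36 * (Real.log (p : ℝ) / (n : ℝ)) * σ₀ ^ 2)) :=
      Real.exp_pos _
    linarith
  rcases τ₀.eq_empty_or_nonempty with h0 | h0
  · rcases Nat.eq_zero_or_pos d with hd | hd
    · apply htriv; rw [hd]; simp
    · refine le_trans (le_of_eq ?_) zero_le
      convert measure_empty (μ := jointMeasure n d)
      rw [Set.eq_empty_iff_forall_notMem]
      intro ω hω
      apply hω ⟨0, hd⟩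
      have := hcard (X.mulVec β₀ + σ₀ • ω.1) (ω.2 ⟨0, hd⟩)
      rw [h0, Finset.card_empty, Nat.le_zero, Finset.card_eq_zero] at this
      rw [this, h0]
  have hp : 0 < p := by obtain ⟨a, _⟩ := h0; exact lt_of_le_of_lt (Nat.zero_le _) a.2
  by_cases hn : τ₀.card + 1 ≤ n
  swap
  · apply htriv
    rw [show n - τ₀.card - 1 = 0 by omega, pow_zero, mul_one]
    apply one_le_pow₀
    have : (1 : ℝ) ≤ (p : ℝ) ^ τ₀.card := one_le_pow₀ (by exact_mod_cast hp)
    linarith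
  set L := 6 * Real.exp (-((n : ℝ) / (18 * σ₀ ^ 2)) *
            ((1 - γ₁ ^ 2) * Cmin X τ₀ β₀ - 36 * (Real.log (p : ℝ) / (n : ℝ)) * σ₀ ^ 2)) with hL
  have hfail := fail_prob X τ₀ β₀ h0 hβsupp hGram σ₀ hσ₀ γ₁ hg0 hg1 (by omega)
  have hgood := good_prob X τ₀ β₀ h0 hGram γ₁ hg0 hg1 hn
  set F := failSet X τ₀ β₀ σ₀ with hF
  set G := goodSet X τ₀ β₀ γ₁ with hG
  have hFm : MeasurableSet F := measurable_failSet X τ₀ β₀ σ₀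
  have hGm : MeasurableSet G := measurable_goodSet X τ₀ β₀ γ₁
  set S : Set ((Fin n → ℝ) × (Fin d → Fin n → ℝ)) := {ω | ∀ b : Fin d, (ω.1, ω.2 b) ∈ F} with hS
  have hSm : MeasurableSet S := by
    rw [hS, Set.ofPred_forall]
    refine MeasurableSet.iInter fun b => ?_
    exact hFm.preimage (f := fun ω : (Fin n → ℝ) × (Fin d → Fin n → ℝ) => (ω.1, ω.2 b))
      (by fun_prop)
  have hsub : {ω : (Fin n → ℝ) × (Fin d → Fin n → ℝ) |
      ∀ b : Fin d, tauHat (X.mulVec β₀ + σ₀ • ω.1) (ω.2 b) ≠ τ₀} ⊆ S := by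
    intro ω hω b
    exact ⟨tauHat (X.mulVec β₀ + σ₀ • ω.1) (ω.2 b), ⟨hω b, hcard _ _⟩, hmin _ _ _ le_rfl⟩
  refine (measure_mono hsub).trans ?_
  unfold jointMeasure
  rw [Measure.prod_apply_symm hSm]
  set Bd : Set (Fin d → Fin n → ℝ) := Set.pi Set.univ (fun _ => Gᶜ) with hBd
  have hBm : MeasurableSet Bd := MeasurableSet.univ_pi fun _ => hGm.compl
  have hpt : ∀ v : Fin d → Fin n → ℝ, stdGaussian n ((fun U => (U, v)) ⁻¹' S) ≤
      ENNReal.ofReal L + Bd.indicator 1 v := by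
    intro v
    by_cases hv : v ∈ Bd
    · rw [Set.indicator_of_mem hv]
      exact prob_le_one.trans le_add_self
    · rw [hBd, Set.mem_univ_pi] at hv
      push Not at hv
      obtain ⟨b, hb⟩ := hv
      rw [Set.mem_compl_iff, not_not] at hb
      refine le_trans ((measure_mono ?_).trans (hfail (v b) hb)) le_self_add
      intro U hU
      exact hU b
  refine (lintegral_mono hpt).trans ?_
  rw [lintegral_add_left measurable_const, lintegral_const, measure_univ, mul_one,
    lintegral_indicator_one hBm, hBd, Measure.pi_pi, Finset.prod_const, Finset.card_univ,
    Fintype.card_fin, ENNReal.ofReal_add (by positivity) (by positivity),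
    ENNReal.ofReal_pow (by positivity)]
  gcongr

end ReproSamples
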